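/- arXiv:2002.07888 — 7 statements merged into one kernel-verified Lean document; each statement's English description precedes it below -/
import Mathlib

section
/- For all real numbers p, q with 0 ≤ p ≤ 1 and 0 ≤ q ≤ 1, dl(p, q) ≥ 0. -/
open Real Finset

/-- lit(p,q) = |p(1 - log p) - q(1 - log q)|, natural log, with 0*log 0 = 0
(automatic since Real.log 0 = 0). -/
noncomputable def lit (p q : ℝ) : ℝ :=
  |p * (1 - Real.log p) - q * (1 - Real.log q)|

/-- δh(p,q) = |p²(1 - 2 log p) - q²(1 - 2 log q)| / (2(p+q)), with δh(0,0) = 0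
(automatic since division by zero is 0 in Lean). -/
noncomputable def deltaH (p q : ℝ) : ℝ :=
  |p ^ 2 * (1 - 2 * Real.log p) - q ^ 2 * (1 - 2 * Real.log q)| / (2 * (p + q))

/-- dl(p,q) = lit(p,q) - δh(p,q). -/
noncomputable def dl (p q : ℝ) : ℝ := lit p q - deltaH p q

/-- DLITE of two distributions on a finite index set: DL(P,Q) = ∑ i, dl(P i, Q i). -/
noncomputable def DL {ι : Type*} [Fintype ι] (P Q : ι → ℝ) : ℝ :=
  ∑ i, dl (P i) (Q i)

/-- `IsProbDist P` : nonnegative real entries summing to 1. -/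
def IsProbDist {ι : Type*} [Fintype ι] (P : ι → ℝ) : Prop :=
  (∀ i, 0 ≤ P i) ∧ ∑ i, P i = 1

theorem mul_one_sub_log_mono {p q : ℝ} (hq : 0 ≤ q) (hqp : q ≤ p) (hp : p ≤ 1) :
    q * (1 - Real.log q) ≤ p * (1 - Real.log p) := by
  have hL : Real.log p ≤ 0 := Real.log_nonpos (hq.trans hqp) hp
  rcases hq.eq_or_lt with rfl | hq
  · rw [zero_mul]
    exact mul_nonneg hqp (by linarith)
  · have hp0 : 0 < p := hq.trans_le hqp
    have h := Real.log_le_sub_one_of_pos (div_pos hp0 hq)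
    rw [Real.log_div hp0.ne' hq.ne'] at h
    have h2 := mul_le_mul_of_nonneg_left h hq.le
    rw [mul_sub q (p / q), mul_div_cancel₀ _ hq.ne'] at h2
    nlinarith [mul_nonneg (sub_nonneg.2 hqp) (neg_nonneg.2 hL)]

theorem two_mul_mul_log_sub_log_le {p q : ℝ} (hq : 0 ≤ q) (hqp : q ≤ p) :
    2 * (p * q) * (Real.log p - Real.log q) ≤ p ^ 2 - q ^ 2 := by
  rcases hq.eq_or_lt with rfl | hq
  · simp [sq_nonneg]
  · have hp : 0 < p := hq.trans_le hqp
    have h : Real.log (p / q) ≤ Real.sinh (Real.log (p / q)) :=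
      Real.self_le_sinh_iff.2 (Real.log_nonneg ((one_le_div hq).2 hqp))
    rw [Real.sinh_log (div_pos hp hq), Real.log_div hp.ne' hq.ne'] at h
    calc 2 * (p * q) * (Real.log p - Real.log q)
        ≤ 2 * (p * q) * ((p / q - (p / q)⁻¹) / 2) := by gcongr
      _ = p ^ 2 - q ^ 2 := by field_simp

theorem dl_comm (p q : ℝ) : dl p q = dl q p := by
  unfold dl lit deltaH
  rw [abs_sub_comm, abs_sub_comm (p ^ 2 * _), add_comm p q]

theorem dl_nonneg_of_le {p q : ℝ} (hq : 0 ≤ q) (hqp : q ≤ p) (hp : p ≤ 1) :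
    0 ≤ dl p q := by
  have hf := mul_one_sub_log_mono hq hqp hp
  have hg := mul_one_sub_log_mono (sq_nonneg q) (pow_le_pow_left₀ hq hqp 2)
    (pow_le_one₀ (hq.trans hqp) hp)
  rw [Real.log_pow, Real.log_pow, Nat.cast_ofNat] at hg
  unfold dl lit deltaH
  rw [abs_of_nonneg (sub_nonneg.2 hf), abs_of_nonneg (sub_nonneg.2 hg), sub_nonneg]
  refine div_le_of_le_mul₀ (by linarith) (sub_nonneg.2 hf) ?_
  linarith [two_mul_mul_log_sub_log_le hq hqp]

theorem dl_nonneg (p q : ℝ) (hp0 : 0 ≤ p) (hp1 : p ≤ 1) (hq0 : 0 ≤ q) (hq1 : q ≤ 1) :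
    0 ≤ dl p q := by
  rcases le_total q p with h | h
  · exact dl_nonneg_of_le hq0 h hp1
  · rw [dl_comm]
    exact dl_nonneg_of_le hp0 h hq1
end

section
/- For all real numbers p, q with 0 ≤ p ≤ 1 and 0 ≤ q ≤ 1, dl(p, q) = 0 if and only if p = q. -/
open Real Finset

theorem mul_log_sub_log_lt {p q : ℝ} (hq : 0 ≤ q) (hqp : q < p) :
    p * q * (Real.log p - Real.log q) < (p ^ 2 - q ^ 2) / 2 := by
  have hp : 0 < p := hq.trans_lt hqp
  rcases hq.eq_or_lt with rfl | hq
  · have : 0 < p ^ 2 / 2 := by positivity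
    simpa using this
  have h : Real.log (p / q) < Real.sinh (Real.log (p / q)) :=
    Real.self_lt_sinh_iff.2 (Real.log_pos ((one_lt_div hq).2 hqp))
  rw [Real.sinh_log (div_pos hp hq), Real.log_div hp.ne' hq.ne'] at h
  calc p * q * (Real.log p - Real.log q)
      < p * q * ((p / q - (p / q)⁻¹) / 2) := mul_lt_mul_of_pos_left h (mul_pos hp hq)
    _ = (p ^ 2 - q ^ 2) / 2 := by field_simp

theorem sq_mul_one_sub_two_mul_log_le {p q : ℝ} (hq : 0 ≤ q) (hqp : q < p) (hp1 : p ≤ 1) :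
    q ^ 2 * (1 - 2 * Real.log q) ≤ p ^ 2 * (1 - 2 * Real.log p) := by
  have hp : 0 < p := hq.trans_lt hqp
  have hlog : Real.log p ≤ 0 := Real.log_nonpos hp.le hp1
  rcases hq.eq_or_lt with rfl | hq
  · have : 0 ≤ p ^ 2 * (1 - 2 * Real.log p) := mul_nonneg (sq_nonneg p) (by linarith)
    simpa using this
  have h := Real.log_le_sub_one_of_pos (show 0 < (p / q) ^ 2 by positivity)
  rw [Real.log_pow, Real.log_div hp.ne' hq.ne'] at h
  have h' := mul_le_mul_of_nonneg_left h (sq_nonneg q)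
  have e : q ^ 2 * ((p / q) ^ 2 - 1) = p ^ 2 - q ^ 2 := by field_simp
  rw [e] at h'
  push_cast at h'
  have h'' : (p ^ 2 - q ^ 2) * Real.log p ≤ 0 :=
    mul_nonpos_of_nonneg_of_nonpos (by nlinarith) hlog
  linarith

theorem dl_pos_of_lt {p q : ℝ} (hq : 0 ≤ q) (hqp : q < p) (hp1 : p ≤ 1) : 0 < dl p q := by
  have hpq : 0 < 2 * (p + q) := by linarith
  have hlog := mul_log_sub_log_lt hq hqp
  rw [dl, lit, deltaH, sub_pos,
    abs_of_nonneg (sub_nonneg.2 (sq_mul_one_sub_two_mul_log_le hq hqp hp1))]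
  refine lt_of_lt_of_le ?_ (le_abs_self _)
  rw [div_lt_iff₀ hpq]
  linarith

theorem dl_eq_zero_iff (p q : ℝ) (hp0 : 0 ≤ p) (hp1 : p ≤ 1) (hq0 : 0 ≤ q) (hq1 : q ≤ 1) :
    dl p q = 0 ↔ p = q := by
  constructor
  · intro h
    rcases lt_trichotomy p q with hlt | heq | hlt
    · exact absurd (dl_comm p q ▸ h) (dl_pos_of_lt hp0 hlt hq1).ne'
    · exact heq
    · exact absurd h (dl_pos_of_lt hq0 hlt hp1).ne'
  · rintro rfl
    simp [dl, lit, deltaH]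
end

section
/- For real numbers c and x with 0 < c ≤ x, the function g(x,c) = x(1 − log x) − c(1 − log c) − (x²(1 − 2 log x) − c²(1 − 2 log c))/(2(x + c)) satisfies g(x,c) ≥ 0, with g(x,c) = 0 exactly when x = c. -/
open Real Finset

/-- Per-coordinate contribution to DLITE without absolute values, valid for x ≥ c. -/
noncomputable def g (x c : ℝ) : ℝ :=
  x * (1 - Real.log x) - c * (1 - Real.log c) -
    (x ^ 2 * (1 - 2 * Real.log x) - c ^ 2 * (1 - 2 * Real.log c)) / (2 * (x + c))

theorem g_eq_mul_sinh_log_sub_log {c x : ℝ} (hc : 0 < c) (hx : 0 < x) :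
    g x c = x * c / (x + c) * (Real.sinh (Real.log (x / c)) - Real.log (x / c)) := by
  have hxc : x + c ≠ 0 := by positivity
  rw [Real.sinh_log (by positivity), Real.log_div hx.ne' hc.ne', g]
  field_simp
  ring

theorem g_nonneg_and_eq_zero_iff (c x : ℝ) (hc : 0 < c) (hcx : c ≤ x) :
    0 ≤ g x c ∧ (g x c = 0 ↔ x = c) := by
  rcases hcx.eq_or_lt with rfl | hlt
  · simp [g]
  · have hx : 0 < x := hc.trans hlt
    have hlog : 0 < Real.log (x / c) := Real.log_pos ((one_lt_div hc).2 hlt)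
    have hpos : 0 < g x c := by
      rw [g_eq_mul_sinh_log_sub_log hc hx]
      exact mul_pos (by positivity) (sub_pos.2 (Real.self_lt_sinh_iff.2 hlog))
    exact ⟨hpos.le, iff_of_false hpos.ne' hlt.ne'⟩
end

section
/- For every natural number m ≥ 1, the DLITE from the uniform distribution on m outcomes (each probability 1/m) to the certainty distribution (probability 1 on one outcome, 0 on the others) equals DL(m) = (1/(m(m+1)) − 1/m)·log m + (1/m − m)/(2(m+1)) + 3(m−1)/(2m). -/
open Real Finset

/-- The function `x (1 - log x)` attains its maximum `1` on the positive reals at `x = 1`. -/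
theorem mul_one_sub_log_le_one {x : ℝ} (hx : 0 < x) : x * (1 - Real.log x) ≤ 1 := by
  have h := mul_le_mul_of_nonneg_left (Real.one_sub_inv_le_log_of_pos hx) hx.le
  rw [mul_sub, mul_inv_cancel₀ hx.ne'] at h
  linarith

theorem dl_one_right {p : ℝ} (hp : 0 < p) :
    dl p 1 = 1 - p * (1 - Real.log p) - (1 - p ^ 2 * (1 - 2 * Real.log p)) / (2 * (p + 1)) := by
  have h₁ := mul_one_sub_log_le_one hp
  have h₂ : p ^ 2 * (1 - 2 * Real.log p) ≤ 1 := by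
    simpa [Real.log_pow] using mul_one_sub_log_le_one (pow_pos hp 2)
  simp only [dl, lit, deltaH, Real.log_one, mul_zero, sub_zero, mul_one, one_pow]
  rw [abs_of_nonpos (sub_nonpos.2 h₁), abs_of_nonpos (sub_nonpos.2 h₂), neg_sub, neg_sub]

theorem dl_zero_right {p : ℝ} (hp : 0 < p) (hp1 : p ≤ 1) : dl p 0 = p / 2 := by
  have hlog := Real.log_nonpos hp.le hp1
  have h₁ : 0 ≤ p * (1 - Real.log p) := mul_nonneg hp.le (by linarith)
  have h₂ : 0 ≤ p ^ 2 * (1 - 2 * Real.log p) := mul_nonneg (sq_nonneg p) (by linarith)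
  simp only [dl, lit, deltaH, zero_mul, sub_zero, add_zero, ne_eq, OfNat.ofNat_ne_zero,
    not_false_eq_true, zero_pow]
  rw [abs_of_nonneg h₁, abs_of_nonneg h₂]
  field_simp
  ring

theorem DL_uniform_to_certainty (m : ℕ) (hm : 1 ≤ m) :
    DL (fun _ : Fin m => (1 : ℝ) / m) (fun i : Fin m => if (i : ℕ) = 0 then (1 : ℝ) else 0) =
      (1 / ((m : ℝ) * (m + 1)) - 1 / m) * Real.log m
        + (1 / (m : ℝ) - m) / (2 * (m + 1)) + 3 * ((m : ℝ) - 1) / (2 * m) := by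
  obtain ⟨n, rfl⟩ := Nat.exists_eq_add_of_le' hm
  have hn : (0 : ℝ) < (n : ℝ) + 1 := by positivity
  have hp : (0 : ℝ) < 1 / ((n : ℝ) + 1) := by positivity
  have hp1 : 1 / ((n : ℝ) + 1) ≤ 1 := by
    rw [div_le_one hn]
    linarith [n.cast_nonneg (α := ℝ)]
  simp only [DL, Fin.sum_univ_succ, Fin.val_zero, Fin.val_succ, if_true, Nat.add_eq_zero_iff,
    one_ne_zero, and_false, if_false, sum_const, card_univ, Fintype.card_fin, nsmul_eq_mul,
    Nat.cast_add, Nat.cast_one]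
  rw [dl_one_right hp, dl_zero_right hp hp1, one_div ((n : ℝ) + 1), Real.log_inv]
  field_simp
  ring
end

section
/- The function DL(m) = (1/(m(m+1)) − 1/m)·log m + (1/m − m)/(2(m+1)) + 3(m−1)/(2m), giving the DLITE required to reduce a uniform distribution on m equiprobable outcomes to certainty, is strictly increasing in m on [1, ∞); equivalently, its derivative DL′(m) = (m²·log m + m + 1)/(m²(m+1)²) is strictly positive for all m ≥ 1. -/
open Real Finset

/-- DLITE from the uniform distribution on m outcomes to certainty, as a function of m. -/
noncomputable def DLm (m : ℝ) : ℝ :=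
  (1 / (m * (m + 1)) - 1 / m) * Real.log m + (1 / m - m) / (2 * (m + 1)) + 3 * (m - 1) / (2 * m)

theorem DLm_eq {m : ℝ} (hm : 0 < m) :
    DLm m = -(Real.log m / (m + 1)) - m⁻¹ + 1 := by
  unfold DLm
  have : m ≠ 0 := hm.ne'
  have : m + 1 ≠ 0 := by positivity
  field_simp
  ring

theorem hasDerivAt_DLm {m : ℝ} (hm : 0 < m) :
    HasDerivAt DLm ((m ^ 2 * Real.log m + m + 1) / (m ^ 2 * (m + 1) ^ 2)) m := by
  have hm0 : m ≠ 0 := hm.ne'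
  have hm1 : m + 1 ≠ 0 := by positivity
  have h := ((((Real.hasDerivAt_log hm0).div ((hasDerivAt_id m).add_const 1) hm1).neg).sub
    (hasDerivAt_inv hm0)).add_const 1
  refine (h.congr_of_eventuallyEq ?_).congr_deriv ?_
  · filter_upwards [lt_mem_nhds hm] with x hx
    simpa using DLm_eq hx
  · simp only [id]
    field_simp
    ring

theorem deriv_formula_pos {m : ℝ} (hm : 1 ≤ m) :
    0 < (m ^ 2 * Real.log m + m + 1) / (m ^ 2 * (m + 1) ^ 2) := by
  have := Real.log_nonneg hm
  positivity

theorem DLm_strictMonoOn :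
    StrictMonoOn DLm (Set.Ici (1 : ℝ)) ∧
      ∀ m : ℝ, 1 ≤ m →
        deriv DLm m = (m ^ 2 * Real.log m + m + 1) / (m ^ 2 * (m + 1) ^ 2) ∧
          0 < (m ^ 2 * Real.log m + m + 1) / (m ^ 2 * (m + 1) ^ 2) := by
  have hpos : ∀ m : ℝ, 1 ≤ m → 0 < m := fun m hm => by linarith
  refine ⟨strictMonoOn_of_deriv_pos (convex_Ici 1)
    (fun x hx => (hasDerivAt_DLm (hpos x hx)).continuousAt.continuousWithinAt) fun x hx => ?_,
    fun m hm => ⟨(hasDerivAt_DLm (hpos m hm)).deriv, deriv_formula_pos hm⟩⟩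
  have hx' : 1 ≤ x := interior_subset hx
  rw [(hasDerivAt_DLm (hpos x hx')).deriv]
  exact deriv_formula_pos hx'
end

section
/- For any probability distributions P and Q on the same finite index set (nonnegative real entries summing to 1), DL(P, Q) ≤ 1. -/
open Real Finset

theorem lit_comm (p q : ℝ) : lit p q = lit q p := abs_sub_comm _ _

theorem deltaH_comm (p q : ℝ) : deltaH p q = deltaH q p := by
  unfold deltaH
  rw [abs_sub_comm, add_comm p q]

theorem dl_zero_right_le {p : ℝ} (hp : 0 ≤ p) (hp1 : p ≤ 1) : dl p 0 ≤ p / 2 := by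
  rcases hp.eq_or_lt with rfl | hp
  · simp [dl, lit, deltaH]
  · have hL : Real.log p ≤ 0 := Real.log_nonpos hp.le hp1
    have hlit : lit p 0 = p * (1 - Real.log p) := by
      simp only [lit, zero_mul, sub_zero]
      exact abs_of_nonneg (mul_nonneg hp.le (by linarith))
    have hdelta : deltaH p 0 = p * (1 - 2 * Real.log p) / 2 := by
      have : 0 ≤ p ^ 2 * (1 - 2 * Real.log p) := mul_nonneg (sq_nonneg p) (by linarith)
      simp only [deltaH, ne_eq, OfNat.ofNat_ne_zero, not_false_eq_true, zero_pow, zero_mul,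
        sub_zero, add_zero, abs_of_nonneg this]
      field_simp
    rw [dl, hlit, hdelta]
    linarith

theorem dl_le_half_add_of_le {p q : ℝ} (hq : 0 ≤ q) (hqp : q ≤ p) (hp1 : p ≤ 1) :
    dl p q ≤ (p + q) / 2 := by
  rcases hq.eq_or_lt with rfl | hq
  · simpa using dl_zero_right_le hqp hp1
  have hp : 0 < p := hq.trans_le hqp
  have hL : Real.log p ≤ 0 := Real.log_nonpos hp.le hp1
  have hML : Real.log q ≤ Real.log p := Real.log_le_log hq hqp
  have hdiff : q * (Real.log p - Real.log q) ≤ p - q := by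
    have h := Real.log_le_sub_one_of_pos (div_pos hp hq)
    rw [Real.log_div hp.ne' hq.ne'] at h
    calc q * (Real.log p - Real.log q) ≤ q * (p / q - 1) := by gcongr
      _ = p - q := by field_simp
  have hlit : lit p q = p * (1 - Real.log p) - q * (1 - Real.log q) := by
    apply abs_of_nonneg
    nlinarith [mul_nonneg (sub_nonneg.2 hqp) (neg_nonneg.2 hL)]
  have hdelta : (p ^ 2 * (1 - 2 * Real.log p) - q ^ 2 * (1 - 2 * Real.log q)) / (2 * (p + q))
      ≤ deltaH p q := by
    unfold deltaH
    gcongr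
    exact le_abs_self _
  have key : p * (1 - Real.log p) - q * (1 - Real.log q) - (p + q) / 2
      ≤ (p ^ 2 * (1 - 2 * Real.log p) - q ^ 2 * (1 - 2 * Real.log q)) / (2 * (p + q)) := by
    rw [le_div_iff₀ (by positivity)]
    nlinarith [mul_nonneg (mul_pos hp hq).le (sub_nonneg.2 hML), mul_pos hp hq, sq_nonneg q]
  rw [dl, hlit]
  linarith

theorem dl_le_half_add {p q : ℝ} (hp : 0 ≤ p) (hp1 : p ≤ 1) (hq : 0 ≤ q) (hq1 : q ≤ 1) :
    dl p q ≤ (p + q) / 2 := by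
  rcases le_total q p with h | h
  · exact dl_le_half_add_of_le hq h hp1
  · rw [dl_comm, add_comm]
    exact dl_le_half_add_of_le hp h hq1

theorem IsProbDist.le_one {ι : Type*} [Fintype ι] {P : ι → ℝ} (hP : IsProbDist P) (i : ι) :
    P i ≤ 1 :=
  hP.2 ▸ Finset.single_le_sum (fun j _ => hP.1 j) (Finset.mem_univ i)

theorem DL_le_one {ι : Type*} [Fintype ι] (P Q : ι → ℝ)
    (hP : IsProbDist P) (hQ : IsProbDist Q) :
    DL P Q ≤ 1 := by
  calc DL P Q ≤ ∑ i, (P i + Q i) / 2 :=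
        Finset.sum_le_sum fun i _ =>
          dl_le_half_add (hP.1 i) (hP.le_one i) (hQ.1 i) (hQ.le_one i)
    _ = 1 := by
        rw [← Finset.sum_div, Finset.sum_add_distrib, hP.2, hQ.2]
        norm_num
end

section
/- Let X and Y be finite index sets, let P_X and Q_X be probability distributions on X, and for each x ∈ X let C_x be a probability distribution on Y (a conditional distribution P_{Y|X=x}, with nonnegative entries summing to 1). For the joint distributions on X × Y given by P_{XY}(x,y) = P_X(x)·C_x(y) and Q_{XY}(x,y) = Q_X(x)·C_x(y) (marginal changes, conditional unchanged), one has DL(P_{XY}, Q_{XY}) = DL(P_X, Q_X). -/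
open Real Finset

theorem mul_one_sub_log_monotoneOn :
    MonotoneOn (fun x : ℝ => x * (1 - Real.log x)) (Set.Icc 0 1) := by
  intro q hq p hp hqp
  obtain ⟨hp0, hp1⟩ := hp
  change q * (1 - Real.log q) ≤ p * (1 - Real.log p)
  have hlog : Real.log p ≤ 0 := Real.log_nonpos hp0 hp1
  rcases hq.1.eq_or_lt with rfl | hq0
  · simp only [zero_mul]
    exact mul_nonneg hp0 (by linarith)
  · have hpq := Real.log_le_sub_one_of_pos (div_pos (hq0.trans_le hqp) hq0)
    rw [Real.log_div (hq0.trans_le hqp).ne' hq0.ne'] at hpq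
    have h := mul_le_mul_of_nonneg_left hpq hq0.le
    rw [mul_sub q (p / q), mul_div_cancel₀ p hq0.ne'] at h
    nlinarith [mul_nonneg (sub_nonneg.2 hqp) (neg_nonneg.2 hlog)]

theorem mul_mul_one_sub_log_mul {c : ℝ} (hc : c ≠ 0) (x : ℝ) :
    c * x * (1 - Real.log (c * x)) = c * (x * (1 - Real.log x) - x * Real.log c) := by
  rcases eq_or_ne x 0 with rfl | hx
  · simp
  · rw [Real.log_mul hc hx]
    ring

/-- The homogeneity defect of `lit` under a common factor `c ∈ [0, 1]`. -/
theorem lit_mul_mul {c p q : ℝ} (hc : c ∈ Set.Icc (0 : ℝ) 1) (hp : p ∈ Set.Icc (0 : ℝ) 1)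
    (hq : q ∈ Set.Icc (0 : ℝ) 1) :
    lit (c * p) (c * q) = c * (lit p q - |p - q| * Real.log c) := by
  wlog hqp : q ≤ p generalizing p q
  · rw [lit_comm (c * p), lit_comm p, abs_sub_comm p]
    exact this hq hp (le_of_not_ge hqp)
  rcases hc.1.eq_or_lt with rfl | hc0
  · simp [lit]
  have hmono := sub_nonneg.2 (mul_one_sub_log_monotoneOn hq hp hqp)
  have hlog : Real.log c ≤ 0 := Real.log_nonpos hc.1 hc.2
  have hscale : c * p * (1 - Real.log (c * p)) - c * q * (1 - Real.log (c * q)) =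
      c * (p * (1 - Real.log p) - q * (1 - Real.log q) - (p - q) * Real.log c) := by
    rw [mul_mul_one_sub_log_mul hc0.ne', mul_mul_one_sub_log_mul hc0.ne']
    ring
  rw [lit, lit, hscale, abs_of_nonneg hmono, abs_of_nonneg (sub_nonneg.2 hqp), abs_of_nonneg]
  exact mul_nonneg hc.1 (sub_nonneg.2
    ((mul_nonpos_of_nonneg_of_nonpos (sub_nonneg.2 hqp) hlog).trans hmono))

theorem deltaH_eq_lit_sq_div (p q : ℝ) :
    deltaH p q = lit (p ^ 2) (q ^ 2) / (2 * (p + q)) := by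
  simp [deltaH, lit, Real.log_pow]

/-- The homogeneity defect of `deltaH` under a common factor `c ∈ [0, 1]`. -/
theorem deltaH_mul_mul {c p q : ℝ} (hc : c ∈ Set.Icc (0 : ℝ) 1) (hp : p ∈ Set.Icc (0 : ℝ) 1)
    (hq : q ∈ Set.Icc (0 : ℝ) 1) :
    deltaH (c * p) (c * q) = c * (deltaH p q - |p - q| * Real.log c) := by
  have hsq {x : ℝ} (hx : x ∈ Set.Icc (0 : ℝ) 1) : x ^ 2 ∈ Set.Icc (0 : ℝ) 1 :=
    ⟨sq_nonneg x, pow_le_one₀ hx.1 hx.2⟩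
  rw [deltaH_eq_lit_sq_div, deltaH_eq_lit_sq_div, mul_pow, mul_pow,
    lit_mul_mul (hsq hc) (hsq hp) (hsq hq), Real.log_pow, sq_sub_sq, abs_mul,
    abs_of_nonneg (add_nonneg hp.1 hq.1)]
  rcases hc.1.eq_or_lt with rfl | hc0
  · simp
  rcases (add_nonneg hp.1 hq.1).eq_or_lt with hpq | hpq
  · obtain rfl : p = 0 := by linarith [hp.1, hq.1]
    obtain rfl : q = 0 := by linarith
    simp
  · rw [← mul_add]
    push_cast
    field_simp

theorem dl_mul_mul {c p q : ℝ} (hc : c ∈ Set.Icc (0 : ℝ) 1) (hp : p ∈ Set.Icc (0 : ℝ) 1)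
    (hq : q ∈ Set.Icc (0 : ℝ) 1) : dl (c * p) (c * q) = c * dl p q := by
  rw [dl, dl, lit_mul_mul hc hp hq, deltaH_mul_mul hc hp hq]
  ring

theorem IsProbDist.mem_Icc {ι : Type*} [Fintype ι] {P : ι → ℝ} (hP : IsProbDist P) (i : ι) :
    P i ∈ Set.Icc (0 : ℝ) 1 :=
  ⟨hP.1 i, hP.2 ▸ Finset.single_le_sum (fun j _ => hP.1 j) (Finset.mem_univ i)⟩

theorem DL_joint_marginal_change {X Y : Type*} [Fintype X] [Fintype Y]
    (PX QX : X → ℝ) (C : X → Y → ℝ)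
    (hPX : IsProbDist PX) (hQX : IsProbDist QX) (hC : ∀ x, IsProbDist (C x)) :
    DL (fun z : X × Y => PX z.1 * C z.1 z.2) (fun z : X × Y => QX z.1 * C z.1 z.2) =
      DL PX QX := by
  simp only [DL, Fintype.sum_prod_type]
  refine Finset.sum_congr rfl fun x _ => ?_
  calc ∑ y, dl (PX x * C x y) (QX x * C x y) = ∑ y, C x y * dl (PX x) (QX x) := by
        refine Finset.sum_congr rfl fun y _ => ?_
        rw [mul_comm (PX x), mul_comm (QX x),
          dl_mul_mul ((hC x).mem_Icc y) (hPX.mem_Icc x) (hQX.mem_Icc x)]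
    _ = dl (PX x) (QX x) := by rw [← Finset.sum_mul, (hC x).2, one_mul]
end
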